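/- q^{|V|} · F_G(q) = ∑_{A⊆E} (−q)^{|A|} · (q−1)^{|E|−|A|} · P_{(V,A)}(q), as an identity of integers; this expresses the flow polynomial value F_G(q) in terms of the chromatic polynomial values P_{(V,A)}(q) of all spanning subgraphs of G. -/

import Mathlib

/-- An additive character turns finite sums into finite products. -/
theorem AddChar.map_sum_eq_prod {ι A M : Type*} [AddCommMonoid A] [CommMonoid M]
    (ψ : AddChar A M) (s : Finset ι) (g : ι → A) :
    ψ (∑ j ∈ s, g j) = ∏ j ∈ s, ψ (g j) := by
  classical
  induction s using Finset.induction_on with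
  | empty => simp
  | insert j s hj ih => rw [Finset.sum_insert hj, Finset.prod_insert hj, AddChar.map_add_eq_mul, ih]

/-- The coloring side of the flow-coloring identity, summed coloring by coloring. -/
theorem sum_edgeSets_mul_card_colorings {V E F : Type*} [Fintype V] [DecidableEq V] [Fintype E]
    [DecidableEq E] [Fintype F] [DecidableEq F] (i f : E → V) (a b : ℂ) :
    ∑ A : Finset E, a ^ A.card * b ^ (Fintype.card E - A.card) *
        (Nat.card {x : V → F // ∀ e ∈ A, x (i e) ≠ x (f e)} : ℂ) =
      ∑ x : V → F, ∏ e, ((if x (i e) ≠ x (f e) then a else 0) + b) := by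
  simp_rw [Fintype.prod_add]
  rw [Finset.sum_comm]
  refine Finset.sum_congr rfl fun A _ => ?_
  have key : ∀ x : V → F, (∏ e ∈ A, (if x (i e) ≠ x (f e) then a else 0)) =
      if ∀ e ∈ A, x (i e) ≠ x (f e) then a ^ A.card else 0 := fun x => by
    rw [Finset.prod_ite_zero, Finset.prod_const]
    congr
  simp_rw [key, Finset.prod_const, Finset.card_compl, ← Finset.sum_mul]
  rw [← Finset.sum_filter, Finset.sum_const, Nat.card_eq_fintype_card, Fintype.card_subtype]
  rw [nsmul_eq_mul]
  ring

/-- The sum of a primitive character over the nonzero multiples of `d`. -/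
theorem AddChar.IsPrimitive.sum_erase_zero {F : Type*} [Field F] [Fintype F] [DecidableEq F]
    {ψ : AddChar F ℂ} (hψ : ψ.IsPrimitive) (d : F) :
    ∑ c ∈ Finset.univ.erase (0 : F), ψ (c * d) =
      (if d ≠ 0 then -(Fintype.card F : ℂ) else 0) + (Fintype.card F - 1) := by
  rw [Finset.sum_erase_eq_sub (Finset.mem_univ _), AddChar.sum_mulShift d hψ]
  by_cases h : d = 0
  · simp [h]
  · simp [h]
    ring

/-- Summation by parts: pairing `k` with the coboundary of `x` is pairing its boundary with `x`. -/
theorem sum_mul_coboundary {V E R : Type*} [Fintype V] [DecidableEq V] [Fintype E] [CommRing R]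
    (i f : E → V) (k : E → R) (x : V → R) :
    ∑ e, k e * (x (f e) - x (i e)) =
      ∑ v, x v * ((∑ e ∈ Finset.univ.filter (fun e : E => f e = v), k e) -
          (∑ e ∈ Finset.univ.filter (fun e : E => i e = v), k e)) := by
  have key : ∀ g : E → V, ∑ v, x v * ∑ e ∈ Finset.univ.filter (fun e : E => g e = v), k e =
      ∑ e, k e * x (g e) := fun g => by
    simp_rw [Finset.sum_filter, Finset.mul_sum]
    rw [Finset.sum_comm]
    simp [mul_comm]
  simp_rw [mul_sub, Finset.sum_sub_distrib, key]

/-- Character sum of the pairing with `d` over all functions `V → F`. -/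
theorem AddChar.IsPrimitive.sum_pi {V F : Type*} [Fintype V] [DecidableEq V] [Field F] [Fintype F]
    [DecidableEq F] {ψ : AddChar F ℂ} (hψ : ψ.IsPrimitive) (d : V → F) :
    ∑ x : V → F, ψ (∑ v, x v * d v) =
      if ∀ v, d v = 0 then (Fintype.card F : ℂ) ^ Fintype.card V else 0 := by
  simp_rw [AddChar.map_sum_eq_prod]
  rw [← Fintype.prod_sum (fun v c => ψ (c * d v))]
  simp_rw [AddChar.sum_mulShift _ hψ]
  push_cast
  rw [Finset.prod_ite_zero]
  simp


/-- Let `G = (V,E,i,f)` be a multigraph and `F` a finite field with `q`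
elements.  Let `F_G(q)` be the number of nowhere-zero flows `k : E → F` (so `k e ≠ 0` for
all `e` and `∑_{f e = v} k e − ∑_{i e = v} k e = 0` for all `v`), and for `A ⊆ E` let
`P_{(V,A)}(q)` be the number of proper colorings `x : V → F` of the spanning subgraph
`(V,A)` (so `x(i e) ≠ x(f e)` for all `e ∈ A`).  Then
`q^{|V|} · F_G(q) = ∑_{A⊆E} (−q)^{|A|} (q−1)^{|E|−|A|} P_{(V,A)}(q)`. -/
theorem stmt_16 {V E F : Type*} [Fintype V] [DecidableEq V] [Fintype E]
    [Field F] [Fintype F]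
    (i f : E → V)
    (FG : ℕ)
    (hFG : FG = Nat.card {k : E → F // (∀ e : E, k e ≠ 0) ∧ ∀ v : V,
        (∑ e ∈ Finset.univ.filter (fun e : E => f e = v), k e) -
          (∑ e ∈ Finset.univ.filter (fun e : E => i e = v), k e) = 0})
    (P : Finset E → ℕ)
    (hP : ∀ A : Finset E,
      P A = Nat.card {x : V → F // ∀ e ∈ A, x (i e) ≠ x (f e)}) :
    (Fintype.card F : ℤ) ^ (Fintype.card V) * FG =
      ∑ A : Finset E, (-(Fintype.card F : ℤ)) ^ A.card *
        ((Fintype.card F : ℤ) - 1) ^ (Fintype.card E - A.card) * P A := by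
  classical
  have hψ : (AddChar.FiniteField.primitiveChar_to_Complex F).IsPrimitive :=
    AddChar.FiniteField.primitiveChar_to_Complex_isPrimitive F
  set ψ := AddChar.FiniteField.primitiveChar_to_Complex F
  have hC : (Fintype.card F : ℂ) ^ (Fintype.card V) * FG =
      ∑ A : Finset E, (-(Fintype.card F : ℂ)) ^ A.card *
        ((Fintype.card F : ℂ) - 1) ^ (Fintype.card E - A.card) * P A := by
    simp_rw [hP]
    rw [sum_edgeSets_mul_card_colorings]
    have hx : ∀ x : V → F, ∏ e, ((if x (i e) ≠ x (f e) then -(Fintype.card F : ℂ) else 0) +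
        (Fintype.card F - 1)) =
        ∑ k ∈ Fintype.piFinset (fun _ : E => Finset.univ.erase (0 : F)),
          ψ (∑ e, k e * (x (f e) - x (i e))) := fun x => by
      simp_rw [AddChar.map_sum_eq_prod]
      rw [← Finset.prod_univ_sum (fun _ : E => Finset.univ.erase (0 : F))
        (fun e c => ψ (c * (x (f e) - x (i e))))]
      simp_rw [hψ.sum_erase_zero, sub_ne_zero, ne_comm]
    simp_rw [hx]
    rw [Finset.sum_comm]
    simp_rw [sum_mul_coboundary, hψ.sum_pi]
    rw [← Finset.sum_filter, Finset.sum_const, nsmul_eq_mul, mul_comm, hFG,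
      Nat.card_eq_fintype_card, Fintype.card_subtype]
    congr 3
    ext k
    simp
  exact_mod_cast hC
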